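/- arXiv:2404.17429 — 2 statements merged into one kernel-verified Lean document; each statement's English description precedes it below -/
import Mathlib

section
/- Let ρ > 0 and w ~ N(0, ρ²). Then the largest eigenvalue of the Hankel matrix of moments B_T = (E[w^{i+j}])_{0≤i,j≤T} satisfies λ_max(B_T) / (√2 (2ρ²T/e)^T) → 1 as T → ∞. -/
open MeasureTheory ProbabilityTheory Filter

/-- recursion for the even moments -/
lemma aux_rec (v : NNReal) (hv : v ≠ 0) (k : ℕ) :
    ∫ x, x ^ (2 * k) ∂(gaussianReal 0 v) =
      (Real.sqrt (2 * Real.pi * v))⁻¹ *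
        ((1 / (2 * (v : ℝ))) ^ (-((k : ℝ) + 1 / 2)) * Real.Gamma ((k : ℝ) + 1 / 2)) := by
  have hv0 : (0 : ℝ) < v := by positivity
  rw [integral_gaussianReal_eq_integral_smul hv]
  have h1 : ∀ x : ℝ, gaussianPDFReal 0 v x • x ^ (2 * k) =
      (Real.sqrt (2 * Real.pi * v))⁻¹ *
        (fun y : ℝ => y ^ (2 * (k : ℝ)) * Real.exp (-(1 / (2 * (v : ℝ))) * y ^ (2 : ℝ))) |x| := by
    intro x
    have e1 : |x| ^ (2 * (k : ℝ)) = x ^ (2 * k) := by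
      rw [show (2 * (k : ℝ)) = ((2 * k : ℕ) : ℝ) by push_cast; ring, Real.rpow_natCast,
        pow_mul, pow_mul, sq_abs]
    have e2 : |x| ^ (2 : ℝ) = x ^ 2 := by
      rw [show (2 : ℝ) = ((2 : ℕ) : ℝ) by norm_num, Real.rpow_natCast, sq_abs]
    simp only [gaussianPDFReal, smul_eq_mul, e1, e2, sub_zero]
    rw [show -x ^ 2 / (2 * (v : ℝ)) = -(1 / (2 * (v : ℝ))) * x ^ 2 by ring]
    ring
  simp_rw [h1]
  rw [integral_const_mul, integral_comp_abs
    (f := fun y : ℝ => y ^ (2 * (k : ℝ)) * Real.exp (-(1 / (2 * (v : ℝ))) * y ^ (2 : ℝ))),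
    integral_rpow_mul_exp_neg_mul_rpow (by norm_num)
      (by have : (0 : ℝ) ≤ k := by positivity
          linarith) (by positivity)]
  rw [show (2 * (k : ℝ) + 1) / 2 = k + 1 / 2 by ring,
    show -(2 * (k : ℝ) + 1) / 2 = -(k + 1 / 2) by ring]
  ring

lemma aux_step (v : NNReal) (hv : v ≠ 0) (k : ℕ) :
    ∫ x, x ^ (2 * (k + 1)) ∂(gaussianReal 0 v) =
      v * (2 * k + 1) * ∫ x, x ^ (2 * k) ∂(gaussianReal 0 v) := by
  have hv0 : (0 : ℝ) < v := by positivity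
  have hb : (0 : ℝ) < 1 / (2 * (v : ℝ)) := by positivity
  rw [aux_rec v hv, aux_rec v hv]
  push_cast
  rw [show ((k : ℝ) + 1 + 1 / 2) = (k + 1 / 2) + 1 by ring, Real.Gamma_add_one (by positivity),
    show -((k : ℝ) + 1 / 2 + 1) = -(k + 1 / 2) + (-1) by ring, Real.rpow_add hb,
    Real.rpow_neg_one]
  field_simp

lemma aux_moment (v : NNReal) (hv : v ≠ 0) (k : ℕ) :
    ∫ x, x ^ (2 * k) ∂(gaussianReal 0 v) =
      (v : ℝ) ^ k * ((2 * k).factorial / (2 ^ k * k.factorial)) := by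
  induction k with
  | zero => simp
  | succ k ih =>
    rw [aux_step v hv, ih, show 2 * (k + 1) = 2 * k + 1 + 1 by ring]
    simp only [Nat.factorial_succ]
    push_cast
    field_simp
    ring

lemma aux_int (v : NNReal) (n : ℕ) : Integrable (fun x : ℝ => x ^ n) (gaussianReal 0 v) := by
  rcases eq_or_ne n 0 with rfl | hn
  · simp
  have := (memLp_id_gaussianReal (μ := 0) (v := v) n)
  have h2 := this.integrable_norm_pow (p := n) (by simpa using hn)
  refine (integrable_norm_iff (by fun_prop)).1 ?_
  simpa using h2

lemma aux_diag {n : Type*} [Fintype n] [DecidableEq n] (A : Matrix n n ℝ) (hA : A.IsHermitian)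
    (i : n) : A i i ≤ ⨆ j, hA.eigenvalues j := by
  set U : Matrix n n ℝ := (hA.eigenvectorUnitary : Matrix n n ℝ) with hU
  have h1 : A i i = ∑ j, U i j ^ 2 * hA.eigenvalues j := by
    conv_lhs => rw [hA.spectral_theorem]
    rw [Unitary.conjStarAlgAut_apply, Matrix.mul_apply]
    refine Finset.sum_congr rfl fun j _ => ?_
    rw [Matrix.mul_diagonal]
    change U i j * hA.eigenvalues j * U i j = _
    ring
  have h2 : ∑ j, U i j ^ 2 = 1 := by
    have h3 : U * star U = 1 := Unitary.mul_star_self_of_mem hA.eigenvectorUnitary.2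
    have h4 : (U * star U) i i = 1 := by rw [h3, Matrix.one_apply_eq]
    rw [Matrix.mul_apply] at h4
    rw [← h4]
    refine Finset.sum_congr rfl fun j _ => ?_
    rw [Matrix.star_apply, star_trivial, sq]
  rw [h1]
  calc _ ≤ ∑ j, U i j ^ 2 * ⨆ j, hA.eigenvalues j := by
        refine Finset.sum_le_sum fun j _ => ?_
        exact mul_le_mul_of_nonneg_left
          (le_ciSup (Set.finite_range hA.eigenvalues).bddAbove j) (sq_nonneg _)
    _ = _ := by rw [← Finset.sum_mul, h2, one_mul]

lemma aux_trace {n : Type*} [Fintype n] [DecidableEq n] [Nonempty n] (A : Matrix n n ℝ)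
    (hA : A.IsHermitian) (hp : A.PosSemidef) : ⨆ j, hA.eigenvalues j ≤ ∑ i, A i i := by
  have ht := hA.trace_eq_sum_eigenvalues
  have h0 : ∀ j, 0 ≤ hA.eigenvalues j := hp.eigenvalues_nonneg
  refine ciSup_le fun j => ?_
  have : ∑ i, A i i = ∑ i, hA.eigenvalues i := by simpa [Matrix.trace] using ht
  rw [this]
  exact Finset.single_le_sum (fun i _ => h0 i) (Finset.mem_univ j)

lemma aux_psd (v : NNReal) (T : ℕ) (A : Matrix (Fin (T + 1)) (Fin (T + 1)) ℝ)
    (hA : A.IsHermitian)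
    (h : ∀ i j, A i j = ∫ x, x ^ ((i : ℕ) + (j : ℕ)) ∂(gaussianReal 0 v)) : A.PosSemidef := by
  refine Matrix.PosSemidef.of_dotProduct_mulVec_nonneg hA fun y => ?_
  have : star y ⬝ᵥ (A.mulVec y) =
      ∫ x, (∑ i, y i * x ^ (i : ℕ)) ^ 2 ∂(gaussianReal 0 v) := by
    have e : ∀ x : ℝ, (∑ i, y i * x ^ (i : ℕ)) ^ 2 =
        ∑ i, ∑ j, (y i * y j) * x ^ ((i : ℕ) + (j : ℕ)) := by
      intro x
      rw [sq, Finset.sum_mul_sum]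
      refine Finset.sum_congr rfl fun i _ => Finset.sum_congr rfl fun j _ => ?_
      rw [pow_add]; ring
    simp_rw [e]
    rw [integral_finsetSum _ fun i _ => integrable_finsetSum _ fun j _ =>
      (aux_int v _).const_mul _]
    simp only [dotProduct, Matrix.mulVec, star_trivial, Finset.mul_sum]
    refine Finset.sum_congr rfl fun i _ => ?_
    rw [integral_finsetSum _ fun j _ => (aux_int v _).const_mul _]
    refine Finset.sum_congr rfl fun j _ => ?_
    rw [integral_const_mul, h]; ring
  rw [this]
  exact integral_nonneg fun x => sq_nonneg _

lemma aux_seq (c : ℝ) (hc : 0 < c) (R : ℕ → ℝ) (h0 : ∀ n, 0 ≤ R n)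
    (hR : ∀ n, R (n + 1) = 1 + R n / (c * (2 * n + 1))) : Tendsto R atTop (nhds 1) := by
  have hlim : Tendsto (fun n : ℕ => c * (2 * (n : ℝ) + 1)) atTop atTop :=
    Tendsto.const_mul_atTop hc
      (tendsto_atTop_add_const_right _ _
        (Tendsto.const_mul_atTop (by norm_num) tendsto_natCast_atTop_atTop))
  obtain ⟨N, hN⟩ := eventually_atTop.1 (hlim.eventually_ge_atTop 2)
  have hb : ∀ n, N ≤ n → R n ≤ R N + 2 := by
    intro n hn
    induction n, hn using Nat.le_induction with
    | base => linarith
    | succ n hn ih =>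
      rw [hR]
      have h2 := hN n hn
      have : R n / (c * (2 * n + 1)) ≤ R n / 2 :=
        div_le_div_of_nonneg_left (h0 n) (by norm_num) h2
      linarith [h0 N]
  rw [← tendsto_add_atTop_iff_nat 1]
  have hz : Tendsto (fun n : ℕ => R n / (c * (2 * (n : ℝ) + 1))) atTop (nhds 0) := by
    refine squeeze_zero' (Eventually.of_forall fun n => ?_)
      (eventually_atTop.2 ⟨N, fun n hn => ?_⟩)
      (hlim.const_div_atTop (R N + 2))
    · exact div_nonneg (h0 n) (by positivity)
    · exact div_le_div_of_nonneg_right (hb n hn) (by positivity)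
  simpa [hR] using hz.const_add 1

lemma aux_stirling (v : ℝ) (hv : 0 < v) :
    Tendsto (fun T : ℕ => v ^ T * ((2 * T).factorial / (2 ^ T * T.factorial)) /
      (Real.sqrt 2 * (2 * v * (T : ℝ) / Real.exp 1) ^ T)) atTop (nhds 1) := by
  have hs := Stirling.tendsto_stirlingSeq_sqrt_pi
  have h2 : Tendsto (fun T : ℕ => Stirling.stirlingSeq (2 * T)) atTop
      (nhds (Real.sqrt Real.pi)) :=
    hs.comp (tendsto_id.const_mul_atTop' (by norm_num))
  have hq := h2.div hs (by positivity)
  rw [div_self (by positivity)] at hq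
  refine hq.congr' ?_
  filter_upwards [eventually_gt_atTop 0] with T hT
  have hT' : (0 : ℝ) < T := by exact_mod_cast hT
  simp only [Pi.div_apply, Stirling.stirlingSeq]
  push_cast
  rw [show (2 * (2 * (T : ℝ))) = 2 * (2 * T) by ring, Real.sqrt_mul (by norm_num) (2 * (T : ℝ))]
  have : 0 < Real.sqrt (2 * T) := by positivity
  rw [pow_mul', sq]
  simp only [div_pow, mul_pow]
  field_simp

theorem stmt8 (ρ : ℝ) (hρ : 0 < ρ)
    (m : ℕ → ℝ)
    (hm : ∀ t, m t = ∫ x, x ^ t ∂(gaussianReal 0 (Real.toNNReal (ρ ^ 2))))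
    (B : (T : ℕ) → Matrix (Fin (T + 1)) (Fin (T + 1)) ℝ)
    (hBdef : ∀ T (i j : Fin (T + 1)), B T i j = m ((i : ℕ) + (j : ℕ)))
    (hB : ∀ T, (B T).IsHermitian) :
    Tendsto
      (fun T => (⨆ i, (hB T).eigenvalues i) /
        (Real.sqrt 2 * (2 * ρ ^ 2 * (T : ℝ) / Real.exp 1) ^ T))
      atTop (nhds 1) := by
  set v := Real.toNNReal (ρ ^ 2) with hvdef
  have hv : (v : ℝ) = ρ ^ 2 := Real.coe_toNNReal _ (by positivity)
  have hv0 : v ≠ 0 := by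
    intro h
    rw [h] at hv
    have : 0 < ρ ^ 2 := by positivity
    rw [← hv] at this
    simp at this
  have hρ2 : 0 < ρ ^ 2 := by positivity
  have hmk : ∀ k, m (2 * k) = (ρ ^ 2) ^ k * ((2 * k).factorial / (2 ^ k * k.factorial)) := by
    intro k; rw [hm, aux_moment v hv0, hv]
  have hstep : ∀ k : ℕ, m (2 * (k + 1)) = ρ ^ 2 * (2 * k + 1) * m (2 * k) := by
    intro k; rw [hm, hm, aux_step v hv0, hv]
  have hpos : ∀ k, 0 < m (2 * k) := by
    intro k; rw [hmk]; positivity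
  have hst := aux_stirling (ρ ^ 2) hρ2
  simp_rw [← hmk] at hst
  have hR := aux_seq (ρ ^ 2) hρ2
    (fun T => (∑ k ∈ Finset.range (T + 1), m (2 * k)) / m (2 * T))
    (fun n => div_nonneg (Finset.sum_nonneg fun k _ => (hpos k).le) (hpos n).le)
    (fun n => by
      have h1 := hpos n
      have h2 : (0 : ℝ) < 2 * n + 1 := by positivity
      rw [Finset.sum_range_succ, hstep]
      field_simp
      ring)
  have hup := hR.mul hst
  rw [one_mul] at hup
  refine tendsto_of_tendsto_of_tendsto_of_le_of_le hst hup (fun T => ?_) (fun T => ?_)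
  · refine div_le_div_of_nonneg_right ?_ (by positivity)
    have := aux_diag (B T) (hB T) (Fin.last T)
    rw [hBdef] at this
    simpa [two_mul] using this
  · have := aux_trace (B T) (hB T) (aux_psd v T (B T) (hB T) fun i j => by rw [hBdef, hm])
    simp only [hBdef] at this
    rw [Fin.sum_univ_eq_sum_range (fun k => m (k + k))] at this
    simp only [← two_mul] at this
    have h1 := (hpos T).ne'
    simp only
    rw [div_mul_div_comm, mul_comm (m (2 * T)), mul_div_mul_right _ _ h1]
    exact div_le_div_of_nonneg_right this (by positivity)
end

section
/- Let N ∈ ℕ* and W be a symmetric N×N random matrix whose entries on and above the diagonal are i.i.d. centred Gaussian with standard deviation σ > 0. Let B_{T,N} be its generalised matrix of moments with largest eigenvalue λ_max(B_{T,N}). Then λ_max(B_{T,N})/B_{T,N}(T,T) → 1 and λ_max(B_{T,N})/tr(B_{T,N}) → 1 as T → ∞ (with N fixed). -/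
open MeasureTheory ProbabilityTheory Matrix Filter

lemma aux_ratio (a : ℕ → ℝ) (hpos : ∀ l, 0 < a l)
    (hlc : ∀ l, a (l + 1) ^ 2 ≤ a l * a (l + 2))
    (hgrow : ∀ K : ℝ, 0 < K → ∃ p : ℝ, 0 < p ∧ ∀ l, p * K ^ l ≤ a l) :
    Tendsto (fun l => a (l + 1) / a l) atTop atTop := by
  have hmono : Monotone fun l => a (l + 1) / a l := by
    refine monotone_nat_of_le_succ fun l => ?_
    rw [div_le_div_iff₀ (hpos _) (hpos _)]
    have := hlc l
    nlinarith
  refine tendsto_atTop_atTop_of_monotone hmono fun C => ?_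
  by_contra! hC
  have hCpos : 0 < C := lt_trans (div_pos (hpos 1) (hpos 0)) (hC 0)
  have hup : ∀ l, a l ≤ a 0 * C ^ l := by
    intro l
    induction l with
    | zero => simp
    | succ l ih =>
      have h := (div_lt_iff₀ (hpos l)).1 (hC l)
      calc a (l + 1) ≤ C * a l := h.le
        _ ≤ C * (a 0 * C ^ l) := by gcongr
        _ = _ := by ring
  obtain ⟨p, hp, hlow⟩ := hgrow (2 * C) (by positivity)
  obtain ⟨n, hn⟩ := pow_unbounded_of_one_lt (a 0 / p) (one_lt_two)
  have h1 := (hlow n).trans (hup n)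
  rw [mul_pow, ← mul_assoc] at h1
  have h2 := le_of_mul_le_mul_right h1 (pow_pos hCpos n)
  rw [div_lt_iff₀ hp] at hn
  linarith

lemma aux_sum (a : ℕ → ℝ) (hpos : ∀ l, 0 < a l)
    (hr : Tendsto (fun l => a (l + 1) / a l) atTop atTop) :
    Tendsto (fun T => (∑ l ∈ Finset.range (T + 1), a l) / a T) atTop (nhds 1) := by
  set q : ℕ → ℝ := fun T => (∑ l ∈ Finset.range (T + 1), a l) / a T with hq
  have hq0 : ∀ T, 0 ≤ q T := fun T =>
    div_nonneg (Finset.sum_nonneg fun l _ => (hpos l).le) (hpos T).le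
  have hrec : ∀ T, q (T + 1) = 1 + q T * (a (T + 1) / a T)⁻¹ := by
    intro T
    simp only [hq]
    rw [Finset.sum_range_succ _ (T + 1)]
    have := (hpos T).ne'
    have := (hpos (T + 1)).ne'
    field_simp
    ring
  have hinv : Tendsto (fun T => (a (T + 1) / a T)⁻¹) atTop (nhds 0) := hr.inv_tendsto_atTop
  obtain ⟨T0, hT0⟩ := eventually_atTop.1 (hr.eventually_ge_atTop 2)
  have hb : ∀ T, T0 ≤ T → q T ≤ max 2 (q T0) := by
    intro T hT
    induction T, hT using Nat.le_induction with
    | base => exact le_max_right _ _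
    | succ T hT ih =>
      rw [hrec]
      have h2 : (a (T + 1) / a T)⁻¹ ≤ 2⁻¹ := inv_anti₀ (by norm_num) (hT0 T hT)
      have h3 : q T * (a (T + 1) / a T)⁻¹ ≤ max 2 (q T0) * 2⁻¹ :=
        mul_le_mul ih h2 (inv_nonneg.2 (div_pos (hpos _) (hpos _)).le)
          (le_trans (by norm_num) (le_max_left _ _))
      have := le_max_left 2 (q T0)
      linarith
  rw [← tendsto_add_atTop_iff_nat 1]
  have hz : Tendsto (fun T => q T * (a (T + 1) / a T)⁻¹) atTop (nhds 0) := by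
    have hz' : Tendsto (fun T => max 2 (q T0) * (a (T + 1) / a T)⁻¹) atTop (nhds 0) := by
      simpa using hinv.const_mul (max 2 (q T0))
    refine tendsto_of_tendsto_of_tendsto_of_le_of_le' tendsto_const_nhds hz' ?_ ?_
    · exact Eventually.of_forall fun T =>
        mul_nonneg (hq0 T) (inv_nonneg.2 (div_pos (hpos _) (hpos _)).le)
    · filter_upwards [eventually_ge_atTop T0] with T hT
      exact mul_le_mul_of_nonneg_right (hb T hT) (inv_nonneg.2 (div_pos (hpos _) (hpos _)).le)
  have := hz.const_add 1
  simp only [add_zero] at this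
  exact this.congr fun T => (hrec T).symm

lemma aux_diag_le {n : ℕ} (A : Matrix (Fin n) (Fin n) ℝ) (hA : A.IsHermitian) (j : Fin n) :
    A j j ≤ ⨆ i, hA.eigenvalues i := by
  have h := hA.spectral_theorem
  have hU : (hA.eigenvectorUnitary : Matrix (Fin n) (Fin n) ℝ)
      * star (hA.eigenvectorUnitary : Matrix (Fin n) (Fin n) ℝ) = 1 :=
    Unitary.coe_mul_star_self _
  rw [Unitary.conjStarAlgAut_apply] at h
  generalize (hA.eigenvectorUnitary : Matrix (Fin n) (Fin n) ℝ) = U at h hU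
  have h1 : A j j = ∑ i, hA.eigenvalues i * (U j i) ^ 2 := by
    have := congrFun (congrFun h j) j
    rw [Matrix.mul_apply] at this
    rw [this]
    refine Finset.sum_congr rfl fun i _ => ?_
    simp [Matrix.mul_diagonal, Matrix.star_apply]
    ring
  have h2 : ∑ i, (U j i) ^ 2 = 1 := by
    have := congrFun (congrFun hU j) j
    rw [Matrix.mul_apply] at this
    simpa [Matrix.star_apply, sq] using this
  rw [h1]
  calc _ ≤ ∑ i, (⨆ i, hA.eigenvalues i) * (U j i) ^ 2 := by
        refine Finset.sum_le_sum fun i _ => ?_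
        exact mul_le_mul_of_nonneg_right (le_ciSup (Set.finite_range _).bddAbove i) (sq_nonneg _)
    _ = _ := by rw [← Finset.mul_sum, h2, mul_one]

lemma aux_le_trace {n : ℕ} (A : Matrix (Fin (n + 1)) (Fin (n + 1)) ℝ) (hA : A.IsHermitian)
    (hp : A.PosSemidef) : ⨆ i, hA.eigenvalues i ≤ A.trace := by
  have h0 : ∀ i, 0 ≤ hA.eigenvalues i := fun i => hp.eigenvalues_nonneg i
  rw [hA.trace_eq_sum_eigenvalues]
  refine ciSup_le fun i => ?_
  exact Finset.single_le_sum (f := fun i => hA.eigenvalues i) (fun i _ => h0 i) (Finset.mem_univ i)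

lemma aux_shift {N : ℕ} (A : Matrix (Fin N) (Fin N) ℝ) (hA : A.IsSymm) (u : Fin N → ℝ) (l : ℕ) :
    ∑ i, ((A ^ l) *ᵥ u) i * ((A ^ (l + 2)) *ᵥ u) i
      = ∑ i, ((A ^ (l + 1)) *ᵥ u) i * ((A ^ (l + 1)) *ᵥ u) i := by
  change ((A ^ l) *ᵥ u) ⬝ᵥ ((A ^ (l + 2)) *ᵥ u)
      = ((A ^ (l + 1)) *ᵥ u) ⬝ᵥ ((A ^ (l + 1)) *ᵥ u)
  have h1 : (A ^ (l + 2)) *ᵥ u = A *ᵥ ((A ^ (l + 1)) *ᵥ u) := by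
    rw [mulVec_mulVec, ← pow_succ']
  have h2 : (A ^ (l + 1)) *ᵥ u = A *ᵥ ((A ^ l) *ᵥ u) := by
    rw [mulVec_mulVec, ← pow_succ']
  rw [h1, dotProduct_mulVec, ← mulVec_transpose, hA.eq, ← h2]

lemma aux_lower {N : ℕ} (A : Matrix (Fin N) (Fin N) ℝ) (K : ℝ) (hK : 0 ≤ K)
    (hA : ∀ i j, K ≤ A i j) (l : ℕ) (i : Fin N) :
    K ^ l ≤ ((A ^ l) *ᵥ (fun _ => (1 : ℝ))) i := by
  induction l generalizing i with
  | zero => simp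
  | succ l ih =>
    rw [pow_succ' A, ← mulVec_mulVec]
    change _ ≤ ∑ j, A i j * ((A ^ l) *ᵥ (fun _ => (1 : ℝ))) j
    have h0 : ∀ j, K * K ^ l ≤ A i j * ((A ^ l) *ᵥ (fun _ => (1 : ℝ))) j := fun j =>
      mul_le_mul (hA i j) (ih j) (by positivity) (hK.trans (hA i j))
    calc K ^ (l + 1) = K * K ^ l := by ring
      _ ≤ _ := h0 i
      _ ≤ _ := Finset.single_le_sum (f := fun j => A i j * ((A ^ l) *ᵥ (fun _ => (1 : ℝ))) j)
        (fun j _ => le_trans (by positivity) (h0 j)) (Finset.mem_univ i)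

lemma aux_memLp {Ω : Type*} [MeasurableSpace Ω] (μ : Measure Ω) [IsProbabilityMeasure μ]
    (N : ℕ) (W : Ω → Matrix (Fin N) (Fin N) ℝ)
    (hW : ∀ (p : NNReal) i j, MemLp (fun ω => W ω i j) p μ) (u : Fin N → ℝ) (l : ℕ) :
    ∀ (p : NNReal) (i : Fin N), MemLp (fun ω => ((W ω ^ l) *ᵥ u) i) p μ := by
  induction l with
  | zero => intro p i; simpa using memLp_const (u i)
  | succ l ih =>
    intro p i
    have h : (fun ω => ((W ω ^ (l + 1)) *ᵥ u) i)
        = fun ω => ∑ j, W ω i j * ((W ω ^ l) *ᵥ u) j := by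
      funext ω
      rw [pow_succ', ← mulVec_mulVec]; rfl
    rw [h]
    refine memLp_finsetSum _ fun j _ => ?_
    have : ENNReal.HolderTriple ((2 * p : NNReal) : ENNReal) ((2 * p : NNReal) : ENNReal)
        (p : ENNReal) := by
      constructor
      push_cast
      rw [ENNReal.mul_inv (by simp) (by simp), ← add_mul, ENNReal.inv_two_add_inv_two, one_mul]
    exact MemLp.mul' (ih (2 * p) j) (hW (2 * p) i j)

theorem stmt12 {Ω : Type*} [MeasurableSpace Ω] (μ : Measure Ω) [IsProbabilityMeasure μ]
    (N : ℕ) (hN : 0 < N) (σ : ℝ) (hσ : 0 < σ)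
    (W : Ω → Matrix (Fin N) (Fin N) ℝ)
    (hWmeas : ∀ i j, Measurable fun ω => W ω i j)
    (hsym : ∀ ω, (W ω).IsSymm)
    (hlaw : Measure.map
        (fun ω => fun p : {p : Fin N × Fin N // p.1 ≤ p.2} => W ω p.1.1 p.1.2) μ
      = Measure.pi fun _ => gaussianReal 0 (Real.toNNReal (σ ^ 2)))
    (u : Fin N → ℝ) (hu : u = fun _ => 1)
    (B : (T : ℕ) → Matrix (Fin (T + 1)) (Fin (T + 1)) ℝ)
    (hBdef : ∀ T (l₁ l₂ : Fin (T + 1)),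
      B T l₁ l₂ = ∫ ω, ∑ i, ((W ω ^ (l₁ : ℕ)) *ᵥ u) i * ((W ω ^ (l₂ : ℕ)) *ᵥ u) i ∂μ)
    (hB : ∀ T, (B T).IsHermitian) :
    Tendsto (fun T => (⨆ i, (hB T).eigenvalues i) / B T (Fin.last T) (Fin.last T))
      atTop (nhds 1) ∧
    Tendsto (fun T => (⨆ i, (hB T).eigenvalues i) / (B T).trace) atTop (nhds 1) := by
  have hXm : Measurable (fun ω => fun p : {p : Fin N × Fin N // p.1 ≤ p.2} =>
      W ω p.1.1 p.1.2) := measurable_pi_lambda _ fun p => hWmeas _ _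
  have hv : Real.toNNReal (σ ^ 2) ≠ 0 := by
    have : 0 < σ ^ 2 := by positivity
    simpa using hσ.ne'
  have hWle : ∀ (p : NNReal) i j, i ≤ j → MemLp (fun ω => W ω i j) p μ := by
    intro p i j hij
    have hmp : MeasurePreserving (fun ω => W ω i j) μ
        (gaussianReal 0 (Real.toNNReal (σ ^ 2))) :=
      (measurePreserving_eval (fun _ : {p : Fin N × Fin N // p.1 ≤ p.2} =>
        gaussianReal 0 (Real.toNNReal (σ ^ 2))) ⟨(i, j), hij⟩).comp ⟨hXm, hlaw⟩
    exact (memLp_id_gaussianReal p).comp_measurePreserving hmp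
  have hW : ∀ (p : NNReal) i j, MemLp (fun ω => W ω i j) p μ := by
    intro p i j
    rcases le_total i j with h | h
    · exact hWle p i j h
    · have : (fun ω => W ω i j) = fun ω => W ω j i := by
        funext ω; exact (hsym ω).apply j i
      rw [this]; exact hWle p j i h
  have hint1 : ∀ k l i, Integrable (fun ω => ((W ω ^ k) *ᵥ u) i * ((W ω ^ l) *ᵥ u) i) μ := by
    intro k l i
    exact MemLp.integrable_mul (p := 2) (q := 2)
      (by simpa using aux_memLp μ N W hW u k 2 i) (by simpa using aux_memLp μ N W hW u l 2 i)
  have hint : ∀ k l, Integrable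
      (fun ω => ∑ i, ((W ω ^ k) *ᵥ u) i * ((W ω ^ l) *ᵥ u) i) μ := fun k l =>
    integrable_finsetSum _ fun i _ => hint1 k l i
  set m : ℕ → ℕ → ℝ := fun k l =>
    ∫ ω, ∑ i, ((W ω ^ k) *ᵥ u) i * ((W ω ^ l) *ᵥ u) i ∂μ with hm
  have hBm : ∀ T (k l : Fin (T + 1)), B T k l = m k l := fun T k l => hBdef T k l
  set a : ℕ → ℝ := fun l => m l l with ha
  -- lower bound
  have hgrow : ∀ K : ℝ, 0 < K → ∃ p : ℝ, 0 < p ∧ ∀ l, p * K ^ l ≤ a l := by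
    intro K hK
    set S : Set Ω := {ω | ∀ i j, Real.sqrt K ≤ W ω i j} with hS
    have hSm : MeasurableSet S := by
      have : S = ⋂ i, ⋂ j, {ω | Real.sqrt K ≤ W ω i j} := by ext; simp [hS]
      rw [this]
      exact MeasurableSet.iInter fun i => MeasurableSet.iInter fun j =>
        measurableSet_le measurable_const (hWmeas i j)
    have hSpos : 0 < μ S := by
      have hSeq : S = (fun ω => fun p : {p : Fin N × Fin N // p.1 ≤ p.2} =>
          W ω p.1.1 p.1.2) ⁻¹' (Set.univ.pi fun _ => Set.Ici (Real.sqrt K)) := by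
        ext ω
        simp only [hS, Set.mem_ofPred_eq, Set.mem_preimage, Set.mem_pi, Set.mem_univ,
          true_implies, Set.mem_Ici]
        refine ⟨fun h p => h _ _, fun h i j => ?_⟩
        rcases le_total i j with hij | hij
        · exact h ⟨(i, j), hij⟩
        · rw [(hsym ω).apply j i]; exact h ⟨(j, i), hij⟩
      rw [hSeq, ← Measure.map_apply hXm (MeasurableSet.univ_pi fun _ => measurableSet_Ici),
        hlaw, Measure.pi_pi]
      refine pos_iff_ne_zero.2 (Finset.prod_ne_zero_iff.2 fun p _ h0 => ?_)
      have := gaussianReal_absolutelyContinuous' 0 hv h0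
      simp at this
    refine ⟨μ.real S, ENNReal.toReal_pos hSpos.ne' (measure_ne_top _ _), fun l => ?_⟩
    have hle : ∫ ω, S.indicator (fun _ => K ^ l) ω ∂μ ≤ a l := by
      refine integral_mono ((integrable_const _).indicator hSm) (hint l l) fun ω => ?_
      have hnn : ∀ i, 0 ≤ ((W ω ^ l) *ᵥ u) i * ((W ω ^ l) *ᵥ u) i := fun i => mul_self_nonneg _
      by_cases hω : ω ∈ S
      · simp only [Set.indicator_of_mem hω]
        have h1 := aux_lower (W ω) (Real.sqrt K) (Real.sqrt_nonneg K) hω l ⟨0, hN⟩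
        rw [← hu] at h1
        calc K ^ l = Real.sqrt K ^ l * Real.sqrt K ^ l := by
              rw [← mul_pow, Real.mul_self_sqrt hK.le]
          _ ≤ ((W ω ^ l) *ᵥ u) ⟨0, hN⟩ * ((W ω ^ l) *ᵥ u) ⟨0, hN⟩ :=
              mul_self_le_mul_self (by positivity) h1
          _ ≤ _ := Finset.single_le_sum
              (f := fun i => ((W ω ^ l) *ᵥ u) i * ((W ω ^ l) *ᵥ u) i)
              (fun i _ => hnn i) (Finset.mem_univ _)
      · simp only [Set.indicator_of_notMem hω]
        exact Finset.sum_nonneg fun i _ => hnn i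
    rwa [integral_indicator_const _ hSm, smul_eq_mul] at hle
  have hpos : ∀ l, 0 < a l := by
    intro l
    obtain ⟨p, hp, h⟩ := hgrow 1 one_pos
    have := h l
    simp only [one_pow, mul_one] at this
    linarith
  -- positive semidefiniteness
  have hpsd : ∀ T, (B T).PosSemidef := by
    intro T
    refine PosSemidef.of_dotProduct_mulVec_nonneg (hB T) fun x => ?_
    have : star x ⬝ᵥ (B T) *ᵥ x
        = ∫ ω, ∑ i, (∑ k : Fin (T + 1), x k * ((W ω ^ (k : ℕ)) *ᵥ u) i) ^ 2 ∂μ := by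
      have e1 : ∀ ω, ∑ i, (∑ k : Fin (T + 1), x k * ((W ω ^ (k : ℕ)) *ᵥ u) i) ^ 2
          = ∑ k : Fin (T + 1), ∑ l : Fin (T + 1), (x k * x l) *
            ∑ i, ((W ω ^ (k : ℕ)) *ᵥ u) i * ((W ω ^ (l : ℕ)) *ᵥ u) i := by
        intro ω
        simp_rw [sq, Finset.sum_mul_sum, Finset.mul_sum]
        rw [Finset.sum_comm]
        refine Finset.sum_congr rfl fun k _ => ?_
        rw [Finset.sum_comm]
        refine Finset.sum_congr rfl fun l _ => Finset.sum_congr rfl fun i _ => ?_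
        ring
      simp_rw [e1]
      have e2 : star x ⬝ᵥ (B T) *ᵥ x
          = ∑ k : Fin (T + 1), ∑ l : Fin (T + 1), (x k * x l) * m k l := by
        simp only [dotProduct, mulVec, Finset.mul_sum, star_trivial, hBm]
        exact Finset.sum_congr rfl fun k _ => Finset.sum_congr rfl fun l _ => by ring
      rw [e2, integral_finsetSum]
      · refine Finset.sum_congr rfl fun k _ => ?_
        rw [integral_finsetSum]
        · refine Finset.sum_congr rfl fun l _ => ?_
          rw [integral_const_mul]
        · exact fun l _ => (hint k l).const_mul _
      · exact fun k _ => integrable_finsetSum _ fun l _ => (hint k l).const_mul _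
    rw [this]
    exact integral_nonneg fun ω => Finset.sum_nonneg fun i _ => sq_nonneg _
  -- log-convexity
  have hlc : ∀ l, a (l + 1) ^ 2 ≤ a l * a (l + 2) := by
    intro l
    have hsh : m l (l + 2) = a (l + 1) := by
      simp only [ha, hm]
      exact integral_congr_ae (Eventually.of_forall fun ω => aux_shift (W ω) (hsym ω) u l)
    have hq : ∀ t : ℝ, 0 ≤ a (l + 2) * (t * t) + (2 * a (l + 1)) * t + a l := by
      intro t
      have : a (l + 2) * (t * t) + (2 * a (l + 1)) * t + a l
          = ∫ ω, ∑ i, (((W ω ^ l) *ᵥ u) i + t * ((W ω ^ (l + 2)) *ᵥ u) i) ^ 2 ∂μ := by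
        have e1 : ∀ ω, ∑ i, (((W ω ^ l) *ᵥ u) i + t * ((W ω ^ (l + 2)) *ᵥ u) i) ^ 2
          = (t * t) * (∑ i, ((W ω ^ (l + 2)) *ᵥ u) i * ((W ω ^ (l + 2)) *ᵥ u) i)
            + (2 * t) * (∑ i, ((W ω ^ l) *ᵥ u) i * ((W ω ^ (l + 2)) *ᵥ u) i)
            + ∑ i, ((W ω ^ l) *ᵥ u) i * ((W ω ^ l) *ᵥ u) i := by
          intro ω
          rw [Finset.mul_sum, Finset.mul_sum, ← Finset.sum_add_distrib,
            ← Finset.sum_add_distrib]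
          exact Finset.sum_congr rfl fun i _ => by ring
        simp_rw [e1]
        rw [integral_add, integral_add, integral_const_mul, integral_const_mul]
        · rw [← hsh]
          simp only [ha, hm]
          ring
        · exact (hint _ _).const_mul _
        · exact (hint _ _).const_mul _
        · exact ((hint _ _).const_mul _).add ((hint _ _).const_mul _)
        · exact hint _ _
      rw [this]
      exact integral_nonneg fun ω => Finset.sum_nonneg fun i _ => sq_nonneg _
    have := discrim_le_zero hq
    unfold discrim at this
    nlinarith
  have htr : ∀ T, (B T).trace = ∑ l ∈ Finset.range (T + 1), a l := by
    intro T
    rw [Finset.sum_range]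
    exact Finset.sum_congr rfl fun l _ => hBm T l l
  have hlast : ∀ T, B T (Fin.last T) (Fin.last T) = a T := by
    intro T
    rw [hBm]; simp [ha]
  have hmain := aux_sum a hpos (aux_ratio a hpos hlc hgrow)
  have hl : ∀ T, a T ≤ ⨆ i, (hB T).eigenvalues i := fun T => by
    rw [← hlast]; exact aux_diag_le _ _ _
  have hr : ∀ T, ⨆ i, (hB T).eigenvalues i ≤ ∑ l ∈ Finset.range (T + 1), a l := fun T => by
    rw [← htr]; exact aux_le_trace _ _ (hpsd T)
  have hS : ∀ T, 0 < ∑ l ∈ Finset.range (T + 1), a l := fun T =>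
    (hpos T).trans_le ((hl T).trans (hr T))
  simp_rw [hlast, htr]
  constructor
  · refine tendsto_of_tendsto_of_tendsto_of_le_of_le tendsto_const_nhds hmain ?_ ?_
    · exact fun T => (one_le_div (hpos T)).2 (hl T)
    · exact fun T => div_le_div_of_nonneg_right (hr T) (hpos T).le
  · have hinv := hmain.inv₀ one_ne_zero
    simp only [inv_div, inv_one] at hinv
    refine tendsto_of_tendsto_of_tendsto_of_le_of_le hinv tendsto_const_nhds ?_ ?_
    · exact fun T => div_le_div_of_nonneg_right (hl T) (hS T).le
    · exact fun T => (div_le_one (hS T)).2 (hr T)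
end
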